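/- arXiv:1812.07243 — 2 statements merged into one kernel-verified Lean document; each statement's English description precedes it below -/
import Mathlib

section
/- Let (K, d) be a compact metric space and Φ ⊆ C(K) a Banach space separating points of K with α‖·‖_Φ ≥ ‖·‖_∞ for some α > 0. Let B be a Φ-stable subset of the space ΦC(K) of Φ-convex upper semicontinuous real functions on K, equipped with the metric ρ_∞(f,g) = sup_x |f(x)−g(x)|/(1+|f(x)−g(x)|). Then the set G = {f ∈ B : K_max(f) ∩ ΦExt(K) is a singleton} is a dense G_δ subset of (B, ρ_∞). -/
/-- a is F-between y and z for a family F of real functions. -/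
def PhiBetween {K : Type*} (F : Set (K → ℝ)) (a y z : K) : Prop :=
  ∀ φ ∈ F, φ y ≤ φ a → φ z ≤ φ a → φ a = φ y ∧ φ a = φ z

/-- e is an F-extremal point of the set A. -/
def PhiExtremalIn {K : Type*} (F : Set (K → ℝ)) (A : Set K) (e : K) : Prop :=
  e ∈ A ∧ ∀ y ∈ A, ∀ z ∈ A, PhiBetween F e y z → y = e ∧ z = e

/-- e is an F-exposed point of the set A. -/
def PhiExposedIn {K : Type*} (F : Set (K → ℝ)) (A : Set K) (e : K) : Prop :=
  e ∈ A ∧ ∃ φ ∈ F, ∀ x ∈ A, x ≠ e → φ x < φ e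

/-- f is F-convex. -/
def PhiConvex {K : Type*} (F : Set (K → ℝ)) (f : K → ℝ) : Prop :=
  ∀ a x y : K, PhiBetween F a x y → f x ≤ f a → f y ≤ f a →
    f x = f a ∧ f y = f a

/-- the set of maximizers of f over the whole space K. -/
def Kmax {K : Type*} (f : K → ℝ) : Set K := {x | ∀ y, f y ≤ f x}

/-- the metric of uniform convergence. -/
noncomputable def rho {K : Type*} (f g : K → ℝ) : ℝ :=
  ⨆ x : K, |f x - g x| / (1 + |f x - g x|)

/-- U is open in B for the metric rho. -/
def RhoOpenIn {K : Type*} (B U : Set (K → ℝ)) : Prop :=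
  U ⊆ B ∧ ∀ f ∈ U, ∃ ε > 0, ∀ g ∈ B, rho f g < ε → g ∈ U

/-- G is dense in B for the metric rho. -/
def RhoDenseIn {K : Type*} (B G : Set (K → ℝ)) : Prop :=
  G ⊆ B ∧ ∀ f ∈ B, ∀ ε > 0, ∃ g ∈ G, rho f g < ε

/-- If no pair in the closed set `C` consists of two maximizers of `f`, the same holds for every
function uniformly close to `f`. -/
theorem exists_forall_not_mem_Kmax {K : Type*} [TopologicalSpace K] [CompactSpace K] [Nonempty K]
    {f : K → ℝ} (hf : UpperSemicontinuous f) {C : Set (K × K)} (hC : IsClosed C)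
    (h : ∀ p ∈ C, p.1 ∈ Kmax f → p.2 ∉ Kmax f) :
    ∃ δ > 0, ∀ g : K → ℝ, (∀ x, |f x - g x| < δ) → ∀ p ∈ C, p.1 ∈ Kmax g → p.2 ∉ Kmax g := by
  rcases C.eq_empty_or_nonempty with rfl | hne
  · exact ⟨1, one_pos, by simp⟩
  obtain ⟨m, -, hm⟩ := (hf.upperSemicontinuousOn _).exists_isMaxOn Set.univ_nonempty isCompact_univ
  have hmin : UpperSemicontinuous fun p : K × K => min (f p.1) (f p.2) :=
    (hf.comp continuous_fst).inf (hf.comp continuous_snd)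
  obtain ⟨q, hqC, hq⟩ := (hmin.upperSemicontinuousOn C).exists_isMaxOn hne hC.isCompact
  have hm' : ∀ y, f y ≤ f m := fun y => hm (Set.mem_univ y)
  have hgap : min (f q.1) (f q.2) < f m := by
    by_contra! hle
    rw [le_min_iff] at hle
    exact h q hqC (fun y => (hm' y).trans hle.1) (fun y => (hm' y).trans hle.2)
  refine ⟨(f m - min (f q.1) (f q.2)) / 2, by linarith, fun g hg p hp h₁ h₂ => ?_⟩
  have hpq : min (f p.1) (f p.2) ≤ min (f q.1) (f q.2) := hq hp
  have a := abs_lt.1 (hg p.1)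
  have b := abs_lt.1 (hg p.2)
  have c := abs_lt.1 (hg m)
  have := h₁ m
  have := h₂ m
  rcases min_le_iff.1 hpq with h' | h' <;> linarith

theorem Kmax_nonempty {K : Type*} [TopologicalSpace K] [CompactSpace K] [Nonempty K]
    {f : K → ℝ} (hf : UpperSemicontinuous f) : (Kmax f).Nonempty := by
  obtain ⟨m, -, hm⟩ := (hf.upperSemicontinuousOn _).exists_isMaxOn Set.univ_nonempty isCompact_univ
  exact ⟨m, fun y => hm (Set.mem_univ y)⟩

theorem isClosed_Kmax {K : Type*} [TopologicalSpace K] {f : K → ℝ} (hf : UpperSemicontinuous f) :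
    IsClosed (Kmax f) := by
  have : Kmax f = ⋂ y, f ⁻¹' Set.Ici (f y) := by ext x; simp [Kmax]
  rw [this]
  exact isClosed_iInter fun y => hf.isClosed_preimage (f y)

/-- Perturbing `f` by `t • ψ` makes the oscillation of `ψ` on the set of maximizers small for some
arbitrarily small `t`. -/
theorem exists_small_oscillation_Kmax {K : Type*} [TopologicalSpace K] [CompactSpace K]
    (f : K → ℝ) (ψ : C(K, ℝ)) {ε δ : ℝ} (hε : 0 < ε) (hδ : 0 < δ) :
    ∃ t, 0 ≤ t ∧ t < δ ∧ ∀ x ∈ Kmax (fun z => f z + t * ψ z),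
      ∀ y ∈ Kmax (fun z => f z + t * ψ z), ψ x - ψ y < ε := by
  by_contra! H
  set t : ℕ → ℝ := fun i => δ * (1 - 1 / ((i : ℝ) + 1)) with ht
  have ht0 : ∀ i, 0 ≤ t i := fun i => by
    have : 1 / ((i : ℝ) + 1) ≤ 1 := by
      rw [div_le_one (by positivity)]; linarith [i.cast_nonneg (α := ℝ)]
    exact mul_nonneg hδ.le (by linarith)
  have htδ : ∀ i, t i < δ := fun i => by
    have : 0 < 1 / ((i : ℝ) + 1) := by positivity
    simp only [ht]; nlinarith
  have htlt : ∀ i, t i < t (i + 1) := fun i => by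
    have : 1 / (((i + 1 : ℕ) : ℝ) + 1) < 1 / ((i : ℝ) + 1) := by
      apply one_div_lt_one_div_of_lt (by positivity); push_cast; linarith
    exact mul_lt_mul_of_pos_left (by linarith) hδ
  choose x hx y hy hxy using fun i => H (t i) (ht0 i) (htδ i)
  have hmono : ∀ i, ψ (x i) ≤ ψ (y (i + 1)) := fun i => by
    have h₁ := hx i (y (i + 1))
    have h₂ := hy (i + 1) (x i)
    have h₃ := htlt i
    simp only at h₁ h₂
    by_contra! hlt
    nlinarith
  have hgrow : ∀ n : ℕ, ψ (y 0) + n * ε ≤ ψ (y n) := by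
    intro n
    induction n with
    | zero => simp
    | succ n ih =>
      push_cast
      linarith [hmono n, hxy n]
  obtain ⟨n, hn⟩ := exists_nat_gt ((2 * ‖ψ‖) / ε)
  rw [div_lt_iff₀ hε] at hn
  have h₁ := abs_le.1 (ψ.norm_coe_le_norm (y 0))
  have h₂ := abs_le.1 (ψ.norm_coe_le_norm (y n))
  linarith [hgrow n]

/-- A point-separating family of continuous functions on a compact metric space has a countable
point-separating subfamily. -/
theorem exists_nat_seq_separatingPoints {K Φ : Type*} [MetricSpace K] [CompactSpace K] [Nonempty Φ]
    (ι : Φ → C(K, ℝ)) (hsep : ∀ x y : K, x ≠ y → ∃ φ : Φ, ι φ x ≠ ι φ y) :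
    ∃ ψ : ℕ → Φ, ∀ x y : K, x ≠ y → ∃ n, ι (ψ n) x ≠ ι (ψ n) y := by
  have : Nonempty (Set.range ι) := (Set.range_nonempty ι).to_subtype
  have hd := TopologicalSpace.denseRange_denseSeq (Set.range ι)
  choose ψ hψ using fun n => (TopologicalSpace.denseSeq (Set.range ι) n).2
  refine ⟨ψ, fun x y hxy => ?_⟩
  obtain ⟨φ, hφ⟩ := hsep x y hxy
  have hopen : IsOpen {g : Set.range ι | g.1 x ≠ g.1 y} :=
    isOpen_ne_fun (by fun_prop) (by fun_prop)
  obtain ⟨n, hn⟩ := hd.exists_mem_open hopen ⟨⟨ι φ, φ, rfl⟩, hφ⟩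
  exact ⟨n, by rw [hψ]; exact hn⟩

/-- Variational principle: arbitrarily small perturbations of an upper semicontinuous function have
a unique maximizer. -/
theorem exists_small_perturbation_Kmax_subsingleton {K : Type*} [MetricSpace K] [CompactSpace K]
    [Nonempty K] {Φ : Type*} [NormedAddCommGroup Φ] [NormedSpace ℝ Φ] [CompleteSpace Φ]
    (ι : Φ →L[ℝ] C(K, ℝ)) (hsep : ∀ x y : K, x ≠ y → ∃ φ : Φ, ι φ x ≠ ι φ y)
    {f : K → ℝ} (hf : UpperSemicontinuous f) {ε : ℝ} (hε : 0 < ε) :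
    ∃ φ : Φ, ‖ι φ‖ < ε ∧ (Kmax fun x => f x + ι φ x).Subsingleton := by
  obtain ⟨ψ, hψ⟩ := exists_nat_seq_separatingPoints ι hsep
  let U : ℕ × ℕ → Set Φ := fun k => {φ | ∀ p ∈ {p : K × K | 1 / ((k.2 : ℝ) + 1) ≤
    ι (ψ k.1) p.1 - ι (ψ k.1) p.2}, p.1 ∈ Kmax (fun x => f x + ι φ x) →
      p.2 ∉ Kmax (fun x => f x + ι φ x)}
  have hUopen : ∀ k, IsOpen (U k) := by
    intro k
    rw [Metric.isOpen_iff]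
    intro φ hφ
    obtain ⟨δ, hδ, H⟩ := exists_forall_not_mem_Kmax
      (hf.add (ι φ).continuous.upperSemicontinuous)
      (isClosed_le continuous_const (by fun_prop)) hφ
    have hnear : ∀ᶠ φ' in nhds φ, dist (ι φ') (ι φ) < δ :=
      ι.continuous.continuousAt (Metric.ball_mem_nhds _ hδ)
    obtain ⟨η, hη, hball⟩ := Metric.eventually_nhds_iff_ball.1 hnear
    refine ⟨η, hη, fun φ' hφ' => H _ fun x => ?_⟩
    have := (ContinuousMap.dist_apply_le_dist (f := ι φ') (g := ι φ) x).trans_lt (hball φ' hφ')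
    rw [dist_comm, Real.dist_eq] at this
    simpa using this
  have hUdense : ∀ k, Dense (U k) := by
    intro k
    rw [Metric.dense_iff]
    intro φ r hr
    have hN : 0 < ‖ψ k.1‖ + 1 := by positivity
    obtain ⟨t, ht0, ht, H⟩ := exists_small_oscillation_Kmax (fun x => f x + ι φ x) (ι (ψ k.1))
      (ε := 1 / ((k.2 : ℝ) + 1)) (by positivity) (div_pos hr hN)
    refine ⟨φ + t • ψ k.1, ?_, ?_⟩
    · rw [lt_div_iff₀ hN] at ht
      rw [mem_ball_iff_norm, add_sub_cancel_left, norm_smul, Real.norm_of_nonneg ht0]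
      nlinarith
    · have heq : (fun x => f x + ι (φ + t • ψ k.1) x) =
          fun x => f x + ι φ x + t * ι (ψ k.1) x := by
        ext x; simp [add_assoc]
      intro p hp h₁ h₂
      rw [heq] at h₁ h₂
      exact (H p.1 h₁ p.2 h₂).not_ge hp
  have hball : IsOpen {φ : Φ | ‖ι φ‖ < ε} := isOpen_lt (by fun_prop) continuous_const
  obtain ⟨φ, hφε, hφ⟩ := (dense_iInter_of_isOpen hUopen hUdense).inter_open_nonempty _ hball
    ⟨0, by simpa using hε⟩
  refine ⟨φ, hφε, fun x hx y hy => ?_⟩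
  by_contra hxy
  obtain ⟨n, hn⟩ := hψ x y hxy
  have key : ∀ u ∈ Kmax (fun x => f x + ι φ x), ∀ v ∈ Kmax (fun x => f x + ι φ x),
      ι (ψ n) u - ι (ψ n) v ≤ 0 := by
    intro u hu v hv
    by_contra! hpos
    obtain ⟨m, hm⟩ := exists_nat_one_div_lt hpos
    exact Set.mem_iInter.1 hφ (n, m) (u, v) hm.le hu hv
  exact hn (le_antisymm (by linarith [key x hx y hy]) (by linarith [key y hy x hx]))

/-- A nonempty closed set has an exposed point. -/
theorem exists_phiExposedIn {K : Type*} [MetricSpace K] [CompactSpace K]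
    {Φ : Type*} [NormedAddCommGroup Φ] [NormedSpace ℝ Φ] [CompleteSpace Φ]
    (ι : Φ →L[ℝ] C(K, ℝ)) (hsep : ∀ x y : K, x ≠ y → ∃ φ : Φ, ι φ x ≠ ι φ y)
    {A : Set K} (hA : IsClosed A) (hne : A.Nonempty) :
    ∃ e, PhiExposedIn {g | ∃ φ : Φ, g = ⇑(ι φ)} A e := by
  have : Nonempty K := hne.to_type
  have husc : UpperSemicontinuous (A.indicator fun _ => (1 : ℝ)) :=
    hA.upperSemicontinuous_indicator zero_le_one
  obtain ⟨φ, hφ, hsub⟩ := exists_small_perturbation_Kmax_subsingleton ι hsep husc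
    (ε := 1 / 2) (by norm_num)
  obtain ⟨e, he⟩ := Kmax_nonempty (husc.add (ι φ).continuous.upperSemicontinuous)
  have heA : e ∈ A := by
    by_contra heA
    obtain ⟨a, ha⟩ := hne
    have h₁ := he a
    simp only [Set.indicator_of_mem ha, Set.indicator_of_notMem heA] at h₁
    have h₂ := abs_le.1 ((ι φ).norm_coe_le_norm e)
    have h₃ := abs_le.1 ((ι φ).norm_coe_le_norm a)
    linarith
  refine ⟨e, heA, _, ⟨φ, rfl⟩, fun x hx hxe => ?_⟩
  by_contra! hle
  refine hxe (hsub (fun y => (he y).trans ?_) he)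
  simp only [Set.indicator_of_mem hx, Set.indicator_of_mem heA]
  linarith

theorem PhiExposedIn.phiExtremalIn {K : Type*} {F : Set (K → ℝ)} {A : Set K} {e : K}
    (he : PhiExposedIn F A e) : PhiExtremalIn F A e := by
  obtain ⟨heA, φ, hφ, hmax⟩ := he
  have hle : ∀ x ∈ A, φ x ≤ φ e := fun x hx => by
    by_cases hxe : x = e
    · rw [hxe]
    · exact (hmax x hx hxe).le
  refine ⟨heA, fun y hy z hz hb => ?_⟩
  obtain ⟨h₁, h₂⟩ := hb φ hφ (hle y hy) (hle z hz)
  exact ⟨by_contra fun h => (hmax y hy h).ne' h₁, by_contra fun h => (hmax z hz h).ne' h₂⟩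

/-- An extremal point of a face cut out by maximizing `ψ ∈ F` over `A` is extremal in `A`. -/
theorem PhiExtremalIn.of_face {K : Type*} {F : Set (K → ℝ)} {A : Set K} {ψ : K → ℝ} (hψ : ψ ∈ F)
    {e : K} (he : PhiExtremalIn F {x ∈ A | ∀ y ∈ A, ψ y ≤ ψ x} e) : PhiExtremalIn F A e := by
  obtain ⟨⟨heA, hmax⟩, hext⟩ := he
  refine ⟨heA, fun y hy z hz hb => ?_⟩
  obtain ⟨h₁, h₂⟩ := hb ψ hψ (hmax y hy) (hmax z hz)
  exact hext y ⟨hy, h₁ ▸ hmax⟩ z ⟨hz, h₂ ▸ hmax⟩ hb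

theorem PhiConvex.phiExtremalIn_univ {K : Type*} {F : Set (K → ℝ)} {f : K → ℝ}
    (hf : PhiConvex F f) {e : K} (he : PhiExtremalIn F (Kmax f) e) :
    PhiExtremalIn F Set.univ e := by
  refine ⟨Set.mem_univ e, fun y _ z _ hb => ?_⟩
  obtain ⟨h₁, h₂⟩ := hf e y z hb (he.1 y) (he.1 z)
  exact he.2 y (fun w => h₁ ▸ he.1 w) z (fun w => h₂ ▸ he.1 w) hb

/-- Every `ψ` in the family attains its maximum over a nonempty closed set at an extremal point. -/
theorem exists_phiExtremalIn_isMaxOn {K : Type*} [MetricSpace K] [CompactSpace K]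
    {Φ : Type*} [NormedAddCommGroup Φ] [NormedSpace ℝ Φ] [CompleteSpace Φ]
    (ι : Φ →L[ℝ] C(K, ℝ)) (hsep : ∀ x y : K, x ≠ y → ∃ φ : Φ, ι φ x ≠ ι φ y)
    {A : Set K} (hA : IsClosed A) (hne : A.Nonempty) (ψ : Φ) :
    ∃ e, PhiExtremalIn {g | ∃ φ : Φ, g = ⇑(ι φ)} A e ∧ ∀ y ∈ A, ι ψ y ≤ ι ψ e := by
  obtain ⟨a, ha, hmax⟩ := hA.isCompact.exists_isMaxOn hne (ι ψ).continuous.continuousOn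
  have hclosed : IsClosed {x ∈ A | ∀ y ∈ A, ι ψ y ≤ ι ψ x} := by
    simp only [Set.ofPred_and, Set.ofPred_forall]
    exact hA.inter (isClosed_biInter fun y _ => isClosed_le continuous_const (ι ψ).continuous)
  obtain ⟨e, he⟩ := exists_phiExposedIn ι hsep hclosed ⟨a, ha, fun y hy => hmax hy⟩
  have hψ : ⇑(ι ψ) ∈ {g : K → ℝ | ∃ φ : Φ, g = ⇑(ι φ)} := ⟨ψ, rfl⟩
  exact ⟨e, he.phiExtremalIn.of_face hψ, he.1.2⟩

/-- The set of maximizers of a `Φ`-convex upper semicontinuous function contains exactly one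
extremal point if and only if it has at most one element. -/
theorem exists_Kmax_inter_eq_singleton_iff {K : Type*} [MetricSpace K] [CompactSpace K] [Nonempty K]
    {Φ : Type*} [NormedAddCommGroup Φ] [NormedSpace ℝ Φ] [CompleteSpace Φ]
    (ι : Φ →L[ℝ] C(K, ℝ)) (hsep : ∀ x y : K, x ≠ y → ∃ φ : Φ, ι φ x ≠ ι φ y)
    {f : K → ℝ} (hf : UpperSemicontinuous f) (hconv : PhiConvex {g | ∃ φ : Φ, g = ⇑(ι φ)} f) :
    (∃ e, Kmax f ∩ {x | PhiExtremalIn {g | ∃ φ : Φ, g = ⇑(ι φ)} Set.univ x} = {e}) ↔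
      (Kmax f).Subsingleton := by
  have hmax := exists_phiExtremalIn_isMaxOn ι hsep (isClosed_Kmax hf) (Kmax_nonempty hf)
  constructor
  · rintro ⟨e, he⟩ x hx y hy
    have hall : ∀ ψ, ∀ u ∈ Kmax f, ι ψ u ≤ ι ψ e := fun ψ u hu => by
      obtain ⟨e', he', hle⟩ := hmax ψ
      have : e' ∈ ({e} : Set K) := he ▸ ⟨he'.1, hconv.phiExtremalIn_univ he'⟩
      exact Set.mem_singleton_iff.1 this ▸ hle u hu
    have heq : ∀ ψ, ∀ u ∈ Kmax f, ι ψ u = ι ψ e := fun ψ u hu =>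
      le_antisymm (hall ψ u hu) (by simpa using hall (-ψ) u hu)
    by_contra hxy
    obtain ⟨ψ, hψ⟩ := hsep x y hxy
    exact hψ ((heq ψ x hx).trans (heq ψ y hy).symm)
  · intro hsub
    obtain ⟨e, he, -⟩ := hmax 0
    refine ⟨e, Set.eq_singleton_iff_unique_mem.2
      ⟨⟨he.1, hconv.phiExtremalIn_univ he⟩, fun x hx => hsub hx.1 he.1⟩⟩

theorem abs_sub_lt_of_rho_lt {K : Type*} {f g : K → ℝ} {δ : ℝ} (hδ : 0 < δ)
    (h : rho f g < δ / (1 + δ)) (x : K) : |f x - g x| < δ := by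
  have hbdd : BddAbove (Set.range fun x => |f x - g x| / (1 + |f x - g x|)) := by
    refine ⟨1, ?_⟩
    rintro _ ⟨y, rfl⟩
    have := abs_nonneg (f y - g y)
    exact div_le_one_of_le₀ (by linarith) (by linarith)
  have hx := (le_ciSup hbdd x).trans_lt h
  have := abs_nonneg (f x - g x)
  rw [div_lt_div_iff₀ (by linarith) (by linarith)] at hx
  linarith

theorem rho_le_of_abs_sub_le {K : Type*} [Nonempty K] {f g : K → ℝ} {δ : ℝ}
    (h : ∀ x, |f x - g x| ≤ δ) : rho f g ≤ δ :=
  ciSup_le fun x => (div_le_self (abs_nonneg _) (by linarith [abs_nonneg (f x - g x)])).trans (h x)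

theorem stmt8 {K : Type*} [MetricSpace K] [CompactSpace K] [Nonempty K]
    {Φ : Type*} [NormedAddCommGroup Φ] [NormedSpace ℝ Φ] [CompleteSpace Φ]
    (ι : Φ →ₗ[ℝ] C(K, ℝ)) (hinj : Function.Injective ι)
    (α : ℝ) (hα : 0 < α) (hnorm : ∀ φ : Φ, ‖ι φ‖ ≤ α * ‖φ‖)
    (hsep : ∀ x y : K, x ≠ y → ∃ φ : Φ, ι φ x ≠ ι φ y)
    (F : Set (K → ℝ)) (hFdef : F = {g | ∃ φ : Φ, g = ⇑(ι φ)})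
    (B : Set (K → ℝ))
    (hB : ∀ f ∈ B, UpperSemicontinuous f ∧ PhiConvex F f)
    (hstable : ∀ f ∈ B, ∀ φ : Φ, (fun x => f x + ι φ x) ∈ B)
    (G : Set (K → ℝ))
    (hGdef : G = {f ∈ B | ∃ e : K,
      Kmax f ∩ {x | PhiExtremalIn F Set.univ x} = {e}}) :
    RhoDenseIn B G ∧
      ∃ O : ℕ → Set (K → ℝ), (∀ n, RhoOpenIn B (O n)) ∧ G = ⋂ n, O n := by
  let L : Φ →L[ℝ] C(K, ℝ) := ι.mkContinuous α hnorm
  have hG : ∀ f, f ∈ G ↔ f ∈ B ∧ (Kmax f).Subsingleton := by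
    intro f
    rw [hGdef, Set.mem_ofPred_eq]
    refine and_congr_right fun hf => ?_
    obtain ⟨husc, hconv⟩ := hB f hf
    subst hFdef
    exact exists_Kmax_inter_eq_singleton_iff L hsep husc hconv
  refine ⟨⟨fun f hf => ((hG f).1 hf).1, fun f hf ε hε => ?_⟩, fun n => {f ∈ B | ∀ p ∈
    {p : K × K | 1 / ((n : ℝ) + 1) ≤ dist p.1 p.2}, p.1 ∈ Kmax f → p.2 ∉ Kmax f},
    fun n => ⟨fun f hf => hf.1, fun f hf => ?_⟩, ?_⟩
  · obtain ⟨φ, hφ, hsub⟩ :=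
      exists_small_perturbation_Kmax_subsingleton L hsep (hB f hf).1 hε
    refine ⟨_, (hG _).2 ⟨hstable f hf φ, hsub⟩, (rho_le_of_abs_sub_le fun x => ?_).trans_lt hφ⟩
    have h : |ι φ x| ≤ ‖L φ‖ := (L φ).norm_coe_le_norm x
    simpa using h
  · obtain ⟨δ, hδ, H⟩ := exists_forall_not_mem_Kmax (hB f hf.1).1
      (isClosed_le continuous_const (by fun_prop)) hf.2
    exact ⟨δ / (1 + δ), by positivity, fun g hg hfg =>
      ⟨hg, H g (abs_sub_lt_of_rho_lt hδ hfg)⟩⟩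
  · ext f
    rw [hG, Set.mem_iInter]
    constructor
    · rintro ⟨hf, hsub⟩ n
      refine ⟨hf, fun p hp h₁ h₂ => ?_⟩
      have hpos : 0 < 1 / ((n : ℝ) + 1) := by positivity
      rw [Set.mem_ofPred_eq, hsub h₁ h₂, dist_self] at hp
      exact hp.not_gt hpos
    · intro h
      refine ⟨(h 0).1, fun x hx y hy => ?_⟩
      by_contra hxy
      obtain ⟨n, hn⟩ := exists_nat_one_div_lt (dist_pos.2 hxy)
      exact (h n).2 (x, y) hn.le hx hy
end

section
/- Let (K, d) be a compact metric space and Φ ⊆ C(K) a Banach space separating the points of K with α‖·‖_Φ ≥ ‖·‖_∞ for some α > 0. For every proper lower semicontinuous f : K → ℝ ∪ {+∞}, the set N(f) = {φ ∈ Φ : f − φ does not attain a unique minimum on K} is of first Baire category in Φ; in particular, the set of φ ∈ Φ such that f − φ attains a strict minimum at exactly one point is dense in Φ. -/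
theorem WithTop.add_coe_le_add_coe_iff (a b : WithTop ℝ) (r s : ℝ) :
    a + (r : WithTop ℝ) ≤ b + (s : WithTop ℝ) ↔ a + ((r - s : ℝ) : WithTop ℝ) ≤ b := by
  induction a with
  | top => induction b <;> simp [← WithTop.coe_add]
  | coe a =>
    induction b with
    | top => simp
    | coe b =>
      norm_cast
      constructor <;> intro h <;> linarith

theorem LowerSemicontinuous.withTop_add_coe {X : Type*} [TopologicalSpace X]
    {f : X → WithTop ℝ} (hf : LowerSemicontinuous f) {u : X → ℝ} (hu : Continuous u) :
    LowerSemicontinuous fun x => f x + (u x : WithTop ℝ) := by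
  intro x a ha
  induction a with
  | top => exact absurd ha not_top_lt
  | coe a =>
    obtain ⟨b, hab, hb⟩ : ∃ b : ℝ, a - u x < b ∧ (b : WithTop ℝ) < f x := by
      cases hfx : f x with
      | top => exact ⟨a - u x + 1, by linarith, WithTop.coe_lt_top _⟩
      | coe c =>
        simp only [hfx] at ha
        norm_cast at ha
        obtain ⟨b, h₁, h₂⟩ := exists_between (show a - u x < c by linarith)
        exact ⟨b, h₁, by exact_mod_cast h₂⟩
    filter_upwards [hf x b hb,
      hu.continuousAt.eventually (lt_mem_nhds (show a - b < u x by linarith))] with y hy hy'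
    cases hfy : f y with
    | top => simp
    | coe c =>
      rw [hfy] at hy
      norm_cast at hy ⊢
      linarith

/-- The point `x` minimizes `f - u`, expressed without subtraction. -/
def IsMinimizerSub {K : Type*} (f : K → WithTop ℝ) (u : K → ℝ) (x : K) : Prop :=
  ∀ z, f x + (u z : WithTop ℝ) ≤ f z + (u x : WithTop ℝ)

theorem IsMinimizerSub.ne_top {K : Type*} {f : K → WithTop ℝ} {u : K → ℝ} {x : K}
    (hx : IsMinimizerSub f u x) (hproper : ∃ x, f x ≠ ⊤) : f x ≠ ⊤ := by
  obtain ⟨z, hz⟩ := hproper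
  intro h
  have := hx z
  simp [h, hz] at this

theorem exists_isMinimizerSub {K : Type*} [TopologicalSpace K] [CompactSpace K] [Nonempty K]
    {f : K → WithTop ℝ} (hf : LowerSemicontinuous f) {u : K → ℝ} (hu : Continuous u) :
    ∃ x, IsMinimizerSub f u x := by
  obtain ⟨x, -, hx⟩ := ((hf.withTop_add_coe hu.neg).lowerSemicontinuousOn
    Set.univ).exists_isMinOn Set.univ_nonempty isCompact_univ
  refine ⟨x, fun z => ?_⟩
  have h := hx (Set.mem_univ z)
  simp only [Set.mem_ofPred_eq, WithTop.add_coe_le_add_coe_iff] at h ⊢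
  convert h using 3
  rw [Pi.neg_apply, Pi.neg_apply]
  ring

theorem exists_ne_isMinimizerSub {K : Type*} [TopologicalSpace K] [CompactSpace K] [Nonempty K]
    {f : K → WithTop ℝ} (hproper : ∃ x, f x ≠ ⊤) (hf : LowerSemicontinuous f)
    {u : K → ℝ} (hu : Continuous u)
    (h : ¬ ∃ x₀ : K, ∀ x : K, x ≠ x₀ →
      f x₀ + (u x : WithTop ℝ) < f x + (u x₀ : WithTop ℝ)) :
    ∃ x y, x ≠ y ∧ IsMinimizerSub f u x ∧ IsMinimizerSub f u y := by
  obtain ⟨x, hx⟩ := exists_isMinimizerSub hf hu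
  push Not at h
  obtain ⟨y, hyx, hy⟩ := h x
  refine ⟨x, y, hyx.symm, hx, fun z => ?_⟩
  have hz := hx z
  have hfx := hx.ne_top hproper
  lift f x to ℝ using hfx with a
  cases hfy : f y with
  | top =>
    rw [hfy] at hy
    norm_cast at hy
  | coe b =>
    rw [hfy] at hy
    cases hfz : f z with
    | top => simp
    | coe c =>
      rw [hfz] at hz
      norm_cast at hy hz ⊢
      linarith

theorem isClosed_setOf_isMinimizerSub {X K : Type*} [TopologicalSpace X] [TopologicalSpace K]
    {f : K → WithTop ℝ} (hf : LowerSemicontinuous f) {u : X → K → ℝ}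
    (hu : Continuous fun p : X × K => u p.1 p.2) :
    IsClosed {p : X × K | IsMinimizerSub f (u p.1) p.2} := by
  simp only [IsMinimizerSub, Set.ofPred_forall, WithTop.add_coe_le_add_coe_iff]
  refine isClosed_iInter fun z => ?_
  have hz : Continuous fun p : X × K => u p.1 z := hu.comp (by fun_prop : Continuous
    fun p : X × K => (p.1, z))
  exact ((hf.comp continuous_snd).withTop_add_coe (hz.sub hu)).isClosed_preimage (f z)

/-- If `x` minimizes `f - u` and `v y < v x`, then `y` does not minimize `f - (u + t v)`. -/
theorem IsMinimizerSub.not_add_mul {K : Type*} {f : K → WithTop ℝ} (hproper : ∃ x, f x ≠ ⊤)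
    {u v : K → ℝ} {x y : K} (hx : IsMinimizerSub f u x) (hv : v y < v x) {t : ℝ} (ht : 0 < t) :
    ¬ IsMinimizerSub f (fun z => u z + t * v z) y := by
  intro hy
  have hfx := hx.ne_top hproper
  have hfy := hy.ne_top hproper
  have h₁ := hx y
  have h₂ := hy x
  lift f x to ℝ using hfx with a
  lift f y to ℝ using hfy with b
  norm_cast at h₁ h₂
  nlinarith [mul_lt_mul_of_pos_left hv ht]

theorem isNowhereDense_setOf_isMinimizerSub_separated {K : Type*} [TopologicalSpace K]
    [CompactSpace K] {Φ : Type*} [NormedAddCommGroup Φ] [NormedSpace ℝ Φ]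
    (L : Φ →L[ℝ] C(K, ℝ)) {f : K → WithTop ℝ} (hproper : ∃ x, f x ≠ ⊤)
    (hf : LowerSemicontinuous f) (ψ : Φ) {c d : ℝ} (hcd : c < d) :
    IsNowhereDense {φ : Φ | ∃ x y, IsMinimizerSub f (L φ) x ∧ IsMinimizerSub f (L φ) y ∧
      d ≤ L ψ x ∧ L ψ y ≤ c} := by
  have hu : Continuous fun p : Φ × K => L p.1 p.2 := by fun_prop
  have hM := isClosed_setOf_isMinimizerSub (u := fun φ => L φ) hf hu
  have hC : IsClosed {p : Φ × (K × K) | IsMinimizerSub f (L p.1) p.2.1 ∧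
      IsMinimizerSub f (L p.1) p.2.2 ∧ d ≤ L ψ p.2.1 ∧ L ψ p.2.2 ≤ c} := by
    refine (hM.preimage (f := fun p : Φ × (K × K) => (p.1, p.2.1)) (by fun_prop)).inter
      ((hM.preimage (f := fun p : Φ × (K × K) => (p.1, p.2.2)) (by fun_prop)).inter
      (IsClosed.inter ?_ ?_))
    · exact isClosed_le (f := fun _ : Φ × (K × K) => d) (g := fun p => L ψ p.2.1)
        (by fun_prop) (by fun_prop)
    · exact isClosed_le (f := fun p : Φ × (K × K) => L ψ p.2.2) (g := fun _ => c)
        (by fun_prop) (by fun_prop)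
  have hN : IsClosed {φ : Φ | ∃ x y, IsMinimizerSub f (L φ) x ∧ IsMinimizerSub f (L φ) y ∧
      d ≤ L ψ x ∧ L ψ y ≤ c} := by
    convert isClosedMap_fst_of_compactSpace _ hC using 1
    ext φ
    simp
  rw [hN.isNowhereDense_iff, Set.eq_empty_iff_forall_notMem]
  intro φ hφ
  obtain ⟨x, -, hx, -, hxd, -⟩ := interior_subset hφ
  have hlim : Filter.Tendsto (fun t : ℝ => φ + t • ψ) (nhdsWithin 0 (Set.Ioi 0)) (nhds φ) := by
    have : Continuous fun t : ℝ => φ + t • ψ := by fun_prop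
    simpa using (this.tendsto 0).mono_left nhdsWithin_le_nhds
  obtain ⟨t, ⟨-, y, -, hy, -, hyc⟩, ht⟩ :=
    ((hlim.eventually (mem_interior_iff_mem_nhds.1 hφ)).and self_mem_nhdsWithin).exists
  refine hx.not_add_mul hproper (v := L ψ) (y := y) (by linarith) ht ?_
  convert hy using 1
  ext z
  simp

theorem stmt18 {K : Type*} [MetricSpace K] [CompactSpace K] [Nonempty K]
    {Φ : Type*} [NormedAddCommGroup Φ] [NormedSpace ℝ Φ] [CompleteSpace Φ]
    (ι : Φ →ₗ[ℝ] C(K, ℝ)) (hinj : Function.Injective ι)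
    (α : ℝ) (hα : 0 < α) (hnorm : ∀ φ : Φ, ‖ι φ‖ ≤ α * ‖φ‖)
    (hsep : ∀ x y : K, x ≠ y → ∃ φ : Φ, ι φ x ≠ ι φ y)
    (f : K → WithTop ℝ) (hproper : ∃ x, f x ≠ ⊤)
    (hlsc : LowerSemicontinuous f) :
    IsMeagre {φ : Φ | ¬ ∃ x₀ : K, ∀ x : K, x ≠ x₀ →
      f x₀ + (ι φ x : WithTop ℝ) < f x + (ι φ x₀ : WithTop ℝ)} ∧
    Dense {φ : Φ | ∃ x₀ : K, ∀ x : K, x ≠ x₀ →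
      f x₀ + (ι φ x : WithTop ℝ) < f x + (ι φ x₀ : WithTop ℝ)} := by
  suffices hmeagre : IsMeagre {φ : Φ | ¬ ∃ x₀ : K, ∀ x : K, x ≠ x₀ →
      f x₀ + (ι φ x : WithTop ℝ) < f x + (ι φ x₀ : WithTop ℝ)} by
    refine ⟨hmeagre, dense_of_mem_residual ?_⟩
    rw [IsMeagre, ← Set.compl_ofPred, compl_compl] at hmeagre
    exact hmeagre
  let L : Φ →L[ℝ] C(K, ℝ) := ι.mkContinuous α hnorm
  let s : Φ × {q : ℝ × ℝ // q.1 < q.2} → Set (K × K) := fun i =>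
    {p | i.2.1.2 < L i.1 p.1 ∧ L i.1 p.2 < i.2.1.1}
  have hs : ∀ i, IsOpen (s i) := fun i =>
    (isOpen_lt (f := fun _ : K × K => i.2.1.2) (g := fun p => L i.1 p.1)
      (by fun_prop) (by fun_prop)).inter
    (isOpen_lt (f := fun p : K × K => L i.1 p.2) (g := fun _ => i.2.1.1)
      (by fun_prop) (by fun_prop))
  obtain ⟨T, hT, hTs⟩ := TopologicalSpace.isOpen_iUnion_countable s hs
  have hcover : ∀ x y : K, x ≠ y → ∃ i ∈ T, (x, y) ∈ s i := by
    intro x y hxy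
    have hmem : (x, y) ∈ ⋃ i, s i := by
      obtain ⟨ψ, hψ⟩ : ∃ ψ, L ψ y < L ψ x := by
        obtain ⟨ψ, hψ⟩ := hsep x y hxy
        rcases hψ.lt_or_gt with h | h
        · exact ⟨-ψ, by simpa [L] using h⟩
        · exact ⟨ψ, h⟩
      obtain ⟨c, hc, hc'⟩ := exists_between hψ
      obtain ⟨d, hd, hd'⟩ := exists_between hc'
      exact Set.mem_iUnion.2 ⟨(ψ, ⟨(c, d), hd⟩), hd', hc⟩
    rw [← hTs] at hmem
    simpa using hmem
  refine IsMeagre.mono (s := ⋃ i ∈ T, {φ : Φ | ∃ x y, IsMinimizerSub f (L φ) x ∧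
    IsMinimizerSub f (L φ) y ∧ i.2.1.2 ≤ L i.1 x ∧ L i.1 y ≤ i.2.1.1}) ?_ ?_
  · intro φ hφ
    obtain ⟨x, y, hxy, hx, hy⟩ := exists_ne_isMinimizerSub hproper hlsc (L φ).continuous hφ
    obtain ⟨i, hi, h₁, h₂⟩ := hcover x y hxy
    exact Set.mem_biUnion hi ⟨x, y, hx, hy, h₁.le, h₂.le⟩
  · exact isMeagre_biUnion hT fun i _ =>
      (isNowhereDense_setOf_isMinimizerSub_separated L hproper hlsc i.1 i.2.2).isMeagre
end
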